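/- There exists a constant C₅ > 0 such that every u ∈ H¹(ℝ) satisfying the orthogonality condition ∫φ₀·u = 0 obeys the coercivity estimate ∫((u')² + V·u²) ≥ C₅·( ∫(u')² + ∫Q̃²·u² ). -/

import Mathlib

open Real MeasureTheory Filter

noncomputable def Qs (x : ℝ) : ℝ := (3/2) * (1 / Real.cosh (x/2))^2
noncomputable def Hs (x : ℝ) : ℝ := Real.tanh (x/2)
noncomputable def alphaFn (x : ℝ) : ℝ := (1/3) * (Real.sinh x + x)
noncomputable def alphaInv : ℝ → ℝ := Function.invFun alphaFn
noncomputable def Qt (x : ℝ) : ℝ := Qs (alphaInv x)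
noncomputable def Ht (x : ℝ) : ℝ := Hs (alphaInv x)
noncomputable def Vpot (x : ℝ) : ℝ := 2 * (Qt x)^2 * (1 - Qt x)

open scoped Topology

lemma Qs_pos (x : ℝ) : 0 < Qs x := by
  have := Real.cosh_pos (x / 2)
  unfold Qs
  positivity

lemma Qs_eq (x : ℝ) : Qs x = 3 / 2 * (1 - Hs x ^ 2) := by
  have h := Real.cosh_pos (x / 2)
  have h2 := Real.cosh_sq (x / 2)
  rw [Qs, Hs, Real.tanh_eq_sinh_div_cosh]
  field_simp
  linarith

lemma hasDerivAt_Hs (x : ℝ) : HasDerivAt Hs (Qs x / 3) x := by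
  have h := Real.cosh_pos (x / 2)
  have h2 := Real.cosh_sq (x / 2)
  have hd : HasDerivAt (fun y : ℝ => y / 2) (1 / 2) x := (hasDerivAt_id x).div_const 2
  have := hd.sinh.div hd.cosh h.ne'
  refine (this.congr_deriv ?_).congr_of_eventuallyEq (Eventually.of_forall fun y => ?_)
  · rw [Qs]
    field_simp
    linarith
  · simp [Hs, Real.tanh_eq_sinh_div_cosh]

lemma hasDerivAt_Qs (x : ℝ) : HasDerivAt Qs (-(Qs x * Hs x)) x := by
  have := (((hasDerivAt_Hs x).pow 2).const_sub 1).const_mul (3 / 2 : ℝ)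
  refine (this.congr_deriv ?_).congr_of_eventuallyEq (Eventually.of_forall fun y => ?_)
  · simp; ring
  · simp [Qs_eq]

lemma hasDerivAt_alphaFn (x : ℝ) : HasDerivAt alphaFn (Qs x)⁻¹ x := by
  have := ((Real.hasDerivAt_sinh x).add (hasDerivAt_id x)).const_mul (1 / 3 : ℝ)
  refine this.congr_deriv ?_
  have h := Real.cosh_pos (x / 2)
  have h2 := Real.cosh_two_mul (x / 2)
  have h3 := Real.cosh_sq (x / 2)
  rw [mul_div_cancel₀ _ (two_ne_zero)] at h2
  rw [Qs]
  field_simp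
  linarith

lemma strictMono_alphaFn : StrictMono alphaFn :=
  strictMono_of_deriv_pos fun x => by
    rw [(hasDerivAt_alphaFn x).deriv]
    exact inv_pos.2 (Qs_pos x)

lemma surjective_alphaFn : Function.Surjective alphaFn := by
  refine Continuous.surjective
    (continuous_iff_continuousAt.2 fun x => (hasDerivAt_alphaFn x).continuousAt) ?_ ?_
  · refine tendsto_atTop_mono' _ ?_ (tendsto_id.const_mul_atTop (by norm_num : (0 : ℝ) < 1 / 3))
    filter_upwards [eventually_ge_atTop 0] with x hx
    have := Real.sinh_nonneg_iff.2 hx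
    simp only [alphaFn, id]
    linarith
  · refine tendsto_atBot_mono' _ ?_ (tendsto_id.const_mul_atBot (by norm_num : (0 : ℝ) < 1 / 3))
    filter_upwards [eventually_le_atBot 0] with x hx
    have := Real.sinh_nonpos_iff.2 hx
    simp only [alphaFn, id]
    linarith

lemma alphaFn_alphaInv (x : ℝ) : alphaFn (alphaInv x) = x :=
  Function.rightInverse_invFun surjective_alphaFn x

lemma continuous_alphaInv : Continuous alphaInv := by
  have : alphaInv = (strictMono_alphaFn.orderIsoOfSurjective _ surjective_alphaFn).symm := by
    ext x
    apply strictMono_alphaFn.injective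
    rw [alphaFn_alphaInv]
    exact ((strictMono_alphaFn.orderIsoOfSurjective _ surjective_alphaFn).apply_symm_apply x).symm
  rw [this]
  exact OrderIso.continuous _

lemma hasDerivAt_alphaInv (x : ℝ) : HasDerivAt alphaInv (Qt x) x := by
  have := HasDerivAt.of_local_left_inverse continuous_alphaInv.continuousAt
    (hasDerivAt_alphaFn (alphaInv x)) (inv_pos.2 (Qs_pos _)).ne'
    (Eventually.of_forall alphaFn_alphaInv)
  simpa [Qt] using this

lemma Qt_pos (x : ℝ) : 0 < Qt x := Qs_pos _

lemma Qt_eq (x : ℝ) : Qt x = 3 / 2 * (1 - Ht x ^ 2) := Qs_eq _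

lemma Qt_le (x : ℝ) : Qt x ≤ 3 / 2 := by
  rw [Qt_eq]
  nlinarith [sq_nonneg (Ht x)]

lemma abs_Ht_le_one (x : ℝ) : |Ht x| ≤ 1 := by
  rw [← sq_le_one_iff_abs_le_one]
  linarith [Qt_pos x, Qt_eq x]

lemma hasDerivAt_Ht (x : ℝ) : HasDerivAt Ht (Qt x ^ 2 / 3) x :=
  ((hasDerivAt_Hs (alphaInv x)).comp x (hasDerivAt_alphaInv x)).congr_deriv (by
    simp only [Qt]; ring)

lemma hasDerivAt_Qt (x : ℝ) : HasDerivAt Qt (-(Qt x ^ 2 * Ht x)) x :=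
  ((hasDerivAt_Qs (alphaInv x)).comp x (hasDerivAt_alphaInv x)).congr_deriv (by
    simp only [Qt, Ht]; ring)

lemma continuous_Qt : Continuous Qt :=
  continuous_iff_continuousAt.2 fun x => (hasDerivAt_Qt x).continuousAt

lemma continuous_Ht : Continuous Ht :=
  continuous_iff_continuousAt.2 fun x => (hasDerivAt_Ht x).continuousAt

lemma continuous_Vpot : Continuous Vpot := by
  have := continuous_Qt
  unfold Vpot
  fun_prop

lemma Ht_zero : Ht 0 = 0 := by
  have : alphaInv 0 = 0 := by
    apply strictMono_alphaFn.injective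
    rw [alphaFn_alphaInv]
    simp [alphaFn]
  simp [Ht, Hs, this]

lemma strictMono_Ht : StrictMono Ht :=
  strictMono_of_deriv_pos fun x => by
    rw [(hasDerivAt_Ht x).deriv]
    have := Qt_pos x
    positivity

lemma Ht_ne_zero {x : ℝ} (hx : x ≠ 0) : Ht x ≠ 0 := fun h =>
  hx (strictMono_Ht.injective (h.trans Ht_zero.symm))

lemma abs_Vpot_le (x : ℝ) : |Vpot x| ≤ 9 := by
  have h1 := Qt_pos x
  have h2 := Qt_le x
  rw [Vpot, abs_mul, abs_of_nonneg (by positivity)]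
  have h3 : |1 - Qt x| ≤ 1 := abs_le.2 ⟨by linarith, by linarith⟩
  nlinarith [abs_nonneg (1 - Qt x), sq_nonneg (Qt x)]

/-- The logarithmic derivative of `Q̃ H̃`, which solves `ψ'' = (2 Q̃² - 3 Q̃³) ψ`. -/
noncomputable def riccati (x : ℝ) : ℝ := Qt x ^ 2 / (3 * Ht x) - Qt x * Ht x

lemma hasDerivAt_riccati {x : ℝ} (hx : x ≠ 0) :
    HasDerivAt riccati (2 * Qt x ^ 2 - 3 * Qt x ^ 3 - riccati x ^ 2) x := by
  have hH := Ht_ne_zero hx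
  have := (((hasDerivAt_Qt x).pow 2).div ((hasDerivAt_Ht x).const_mul 3)
    (mul_ne_zero three_ne_zero hH)).sub ((hasDerivAt_Qt x).mul (hasDerivAt_Ht x))
  refine this.congr_deriv ?_
  have hQ : Ht x ^ 2 = 1 - 2 / 3 * Qt x := by rw [Qt_eq]; ring
  have h4 : Ht x ^ 4 = (1 - 2 / 3 * Qt x) ^ 2 := by rw [← hQ]; ring
  simp only [riccati, Pi.pow_apply]
  field_simp
  ring_nf
  rw [h4, hQ]
  ring

lemma abs_riccati_le {x : ℝ} (hx : x ≠ 0) : |riccati x| ≤ 3 / (4 * |Ht x|) + 3 / 2 := by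
  have hH := abs_pos.2 (Ht_ne_zero hx)
  have h1 := Qt_pos x
  have h2 := Qt_le x
  refine (abs_sub _ _).trans (add_le_add ?_ ?_)
  · rw [abs_div, abs_mul, abs_of_pos (by positivity : 0 < Qt x ^ 2), abs_of_pos (by norm_num),
      div_le_div_iff₀ (by positivity) (by positivity)]
    have h3 : Qt x ^ 2 ≤ 9 / 4 := by nlinarith
    nlinarith
  · rw [abs_mul, abs_of_pos h1]
    nlinarith [abs_Ht_le_one x]

lemma tendsto_mul_riccati : Tendsto (fun x => x * riccati x) (𝓝[≠] 0) (𝓝 1) := by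
  have h1 := hasDerivAt_iff_tendsto_slope_zero.1 (hasDerivAt_Ht 0)
  have hQ : Tendsto Qt (𝓝[≠] 0) (𝓝 (Qt 0)) :=
    continuous_Qt.continuousAt.tendsto.mono_left nhdsWithin_le_nhds
  have hH : Tendsto Ht (𝓝[≠] 0) (𝓝 (Ht 0)) :=
    continuous_Ht.continuousAt.tendsto.mono_left nhdsWithin_le_nhds
  have hi : Tendsto (fun x : ℝ => x) (𝓝[≠] 0) (𝓝 0) := tendsto_id.mono_left nhdsWithin_le_nhds
  have hp := Qt_pos 0
  have := ((hQ.pow 2).div (h1.const_mul 3) (by positivity)).sub (hi.mul (hQ.mul hH))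
  have he : Qt 0 ^ 2 / (3 * (Qt 0 ^ 2 / 3)) - 0 * (Qt 0 * Ht 0) = 1 := by field_simp; simp
  rw [he] at this
  refine this.congr' ?_
  filter_upwards [self_mem_nhdsWithin] with x hx
  have hx' : x ≠ 0 := hx
  have := Ht_ne_zero hx'
  simp only [zero_add, Ht_zero, sub_zero, smul_eq_mul, riccati, Pi.div_apply]
  field_simp

lemma hasDerivAt_riccati_mul_sq_zero {w : ℝ → ℝ} {w' : ℝ} (hw : HasDerivAt w w' 0)
    (h0 : w 0 = 0) : HasDerivAt (fun x => riccati x * w x ^ 2) (w' ^ 2) 0 := by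
  rw [hasDerivAt_iff_tendsto_slope_zero] at hw ⊢
  have := tendsto_mul_riccati.mul (hw.pow 2)
  rw [one_mul] at this
  refine this.congr' ?_
  filter_upwards [self_mem_nhdsWithin] with x hx
  have hx' : x ≠ 0 := hx
  simp only [zero_add, h0, smul_eq_mul]
  field_simp
  ring

lemma integrable_mul_of_sq {f g : ℝ → ℝ} (hf : Measurable f) (hg : Measurable g)
    (hf2 : Integrable fun x => f x ^ 2) (hg2 : Integrable fun x => g x ^ 2) :
    Integrable fun x => f x * g x := by
  refine (hf2.add hg2).mono' (hf.mul hg).aestronglyMeasurable (Eventually.of_forall fun x => ?_)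
  rw [Real.norm_eq_abs, abs_mul, Pi.add_apply, ← sq_abs (f x), ← sq_abs (g x)]
  nlinarith [sq_nonneg (|f x| - |g x|), sq_nonneg (|f x|), sq_nonneg (|g x|)]

lemma integrable_bounded_mul {f g : ℝ → ℝ} {C : ℝ} (hf : Continuous f) (hC : ∀ x, |f x| ≤ C)
    (hg : Integrable g) : Integrable fun x => f x * g x :=
  hg.bdd_mul hf.aestronglyMeasurable (Eventually.of_forall hC)

lemma integrable_Qt_sq_mul {g : ℝ → ℝ} (hg : Integrable g) :
    Integrable fun x => Qt x ^ 2 * g x :=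
  integrable_bounded_mul (C := 9) (continuous_Qt.pow 2) (fun x => by
    have h1 := Qt_pos x
    rw [abs_of_pos (by positivity)]
    nlinarith [Qt_le x]) hg

/-- Coercivity on functions vanishing at the origin, by comparison with `Q̃ H̃`. -/
lemma coercive_of_apply_zero_eq_zero {w : ℝ → ℝ} (hd : Differentiable ℝ w)
    (hw : Integrable fun x => w x ^ 2) (hw' : Integrable fun x => deriv w x ^ 2)
    (h0 : w 0 = 0) :
    1 / 3 * ((∫ x, deriv w x ^ 2) + ∫ x, Qt x ^ 2 * w x ^ 2)
      ≤ ∫ x, (deriv w x ^ 2 + Vpot x * w x ^ 2) := by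
  have hQ := integrable_Qt_sq_mul hw
  have hV := integrable_bounded_mul continuous_Vpot abs_Vpot_le hw
  set φ : ℝ → ℝ := fun x => (deriv w x ^ 2 + Vpot x * w x ^ 2)
    - 1 / 3 * (deriv w x ^ 2 + Qt x ^ 2 * w x ^ 2) with hφ
  have hφi : Integrable φ := (hw'.add hV).sub ((hw'.add hQ).const_mul _)
  have hφe : ∫ x, φ x = (∫ x, (deriv w x ^ 2 + Vpot x * w x ^ 2))
      - 1 / 3 * ((∫ x, deriv w x ^ 2) + ∫ x, Qt x ^ 2 * w x ^ 2) := by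
    rw [← integral_add hw' hQ, ← integral_const_mul]
    exact integral_sub (hw'.add hV) ((hw'.add hQ).const_mul _)
  suffices 0 ≤ ∫ x, φ x by linarith
  set G : ℝ → ℝ := fun x => 2 / 3 * (riccati x * w x ^ 2) with hG
  have hGd (x : ℝ) : ∃ G', HasDerivAt G G' x ∧ G' ≤ φ x := by
    have hQx := Qt_pos x
    by_cases hx : x = 0
    · subst hx
      refine ⟨_, (hasDerivAt_riccati_mul_sq_zero (hd 0).hasDerivAt h0).const_mul _, ?_⟩
      simp only [hφ, h0]
      apply le_of_eq
      ring
    · refine ⟨_, ((hasDerivAt_riccati hx).mul ((hd x).hasDerivAt.pow 2)).const_mul _, ?_⟩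
      simp only [hφ, Vpot, Pi.pow_apply]
      have h1 := sq_nonneg (deriv w x - riccati x * w x)
      have h2 : 0 ≤ Qt x ^ 2 * w x ^ 2 := by positivity
      norm_num
      nlinarith
  choose G' hG' hle using hGd
  have hsq (x : ℝ) : HasDerivAt (fun x => w x ^ 2) (2 * (w x * deriv w x)) x :=
    ((hd x).hasDerivAt.pow 2).congr_deriv (by norm_num; ring)
  have hsqi :=
    (integrable_mul_of_sq hd.continuous.measurable (measurable_deriv w) hw hw').const_mul 2
  have hbound (c : ℝ) (hc : 0 < c) (x : ℝ) (hx : c ≤ |Ht x|) :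
      ‖G x‖ ≤ (3 / (4 * c) + 3 / 2) * w x ^ 2 := by
    have hx0 : x ≠ 0 := by
      rintro rfl
      rw [Ht_zero, abs_zero] at hx
      linarith
    have h1 : 3 / (4 * |Ht x|) ≤ 3 / (4 * c) := by gcongr
    have h2 := abs_riccati_le hx0
    rw [Real.norm_eq_abs, hG, abs_mul, abs_mul, abs_of_nonneg (sq_nonneg (w x)),
      abs_of_pos (by norm_num)]
    have h3 := mul_le_mul_of_nonneg_right (h2.trans (add_le_add_left h1 _)) (sq_nonneg (w x))
    have h4 : 0 ≤ |riccati x| * w x ^ 2 := by positivity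
    linarith
  have hpos1 : 0 < Ht 1 := Ht_zero ▸ strictMono_Ht one_pos
  have hneg1 : Ht (-1) < 0 := Ht_zero ▸ strictMono_Ht (by norm_num : (-1 : ℝ) < 0)
  have htop : Tendsto G atTop (𝓝 0) := by
    have h := (tendsto_zero_of_hasDerivAt_of_integrableOn_Ioi (a := 0) (fun x _ => hsq x)
      hsqi.integrableOn hw.integrableOn).const_mul (3 / (4 * Ht 1) + 3 / 2)
    rw [mul_zero] at h
    refine squeeze_zero_norm' ?_ h
    filter_upwards [eventually_ge_atTop 1] with x hx
    exact hbound _ hpos1 x ((strictMono_Ht.monotone hx).trans (le_abs_self _))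
  have hbot : Tendsto G atBot (𝓝 0) := by
    have h := (tendsto_zero_of_hasDerivAt_of_integrableOn_Iic (a := 0) (fun x _ => hsq x)
      hsqi.integrableOn hw.integrableOn).const_mul (3 / (4 * -Ht (-1)) + 3 / 2)
    rw [mul_zero] at h
    refine squeeze_zero_norm' ?_ h
    filter_upwards [eventually_le_atBot (-1)] with x hx
    exact hbound _ (neg_pos.2 hneg1) x
      ((neg_le_neg (strictMono_Ht.monotone hx)).trans (neg_le_abs _))
  have hlim := intervalIntegral_tendsto_integral hφi tendsto_neg_atTop_atBot tendsto_id
  have hGlim := htop.sub (hbot.comp tendsto_neg_atTop_atBot)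
  rw [sub_zero] at hGlim
  refine le_of_tendsto_of_tendsto hGlim hlim ?_
  filter_upwards [eventually_ge_atTop 0] with x hx
  exact intervalIntegral.sub_le_integral_of_hasDeriv_right_of_le (by simp; linarith)
    (fun y _ => (hG' y).continuousAt.continuousWithinAt) (fun y _ => (hG' y).hasDerivWithinAt)
    hφi.integrableOn (fun y _ => hle y)

lemma integrable_exp_neg_mul_abs {c : ℝ} (hc : 0 < c) :
    Integrable fun x : ℝ => Real.exp (-c * |x|) := by
  rw [← integrableOn_univ, ← Set.Iic_union_Ioi (a := (0 : ℝ))]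
  refine IntegrableOn.union ?_ ?_
  · refine (integrableOn_exp_mul_Iic hc 0).congr_fun (fun x hx => ?_) measurableSet_Iic
    simp [abs_of_nonpos (Set.mem_Iic.1 hx)]
  · refine (integrableOn_exp_mul_Ioi (neg_lt_zero.2 hc) 0).congr_fun (fun x hx => ?_)
      measurableSet_Ioi
    simp [abs_of_pos (Set.mem_Ioi.1 hx)]

lemma integral_bilinear_eq {φ : ℝ → ℝ} {μ : ℝ} (hC2 : ContDiff ℝ 2 φ)
    (hφ : Integrable fun x => φ x ^ 2) (hφ' : Integrable fun x => deriv φ x ^ 2)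
    (heq : ∀ x, -(deriv (deriv φ) x) + Vpot x * φ x = -μ ^ 2 * φ x)
    {u : ℝ → ℝ} (hd : Differentiable ℝ u) (hu : Integrable fun x => u x ^ 2)
    (hu' : Integrable fun x => deriv u x ^ 2) :
    Integrable (fun x => deriv φ x * deriv u x + Vpot x * (φ x * u x)) ∧
    ∫ x, (deriv φ x * deriv u x + Vpot x * (φ x * u x)) = -μ ^ 2 * ∫ x, φ x * u x := by
  have hmu := hd.continuous.measurable
  have hdφ : Differentiable ℝ (deriv φ) :=
    ((contDiff_succ_iff_deriv (n := 1)).1 hC2).2.2.differentiable (by norm_num)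
  have i1 := integrable_mul_of_sq (measurable_deriv φ) (measurable_deriv u) hφ' hu'
  have i2 := integrable_mul_of_sq hC2.continuous.measurable hmu hφ hu
  have i3 := integrable_mul_of_sq (measurable_deriv φ) hmu hφ' hu
  have i4 := i1.add (integrable_bounded_mul continuous_Vpot abs_Vpot_le i2)
  refine ⟨i4, ?_⟩
  have key := integral_eq_zero_of_hasDerivAt_of_integrable
    (f' := fun x => (deriv φ x * deriv u x + Vpot x * (φ x * u x)) + μ ^ 2 * (φ x * u x))
    (fun x => ((hdφ x).hasDerivAt.mul (hd x).hasDerivAt).congr_deriv (by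
      linear_combination -u x * heq x)) (i4.add (i2.const_mul _)) i3
  have hsplit := integral_add i4 (i2.const_mul (μ ^ 2))
  rw [integral_const_mul] at hsplit
  simp only [Pi.add_apply] at hsplit
  linarith

/-- Coercivity of the quadratic form of `L = −∂ₓ² + V` on `H¹(ℝ)`
under the orthogonality condition `⟨φ₀,u⟩ = 0`. -/
theorem L_coercivity (φ₀ : ℝ → ℝ) (μ₀ : ℝ)
    (hC2 : ContDiff ℝ 2 φ₀) (hpos : ∀ x : ℝ, 0 < φ₀ x)
    (heven : ∀ x : ℝ, φ₀ (-x) = φ₀ x)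
    (hL2 : Integrable (fun x => (φ₀ x)^2))
    (hμ1 : (0.808:ℝ) ≤ μ₀) (hμ2 : μ₀ ≤ (0.883:ℝ))
    (heq : ∀ x : ℝ, -(deriv (deriv φ₀) x) + Vpot x * φ₀ x = -μ₀^2 * φ₀ x)
    (hdecay : ∃ C > (0:ℝ), ∀ x : ℝ,
      |φ₀ x| + |deriv φ₀ x| ≤ C * Real.exp (-(Real.sqrt 2 / 2) * μ₀ * |x|)) :
    ∃ C₅ > (0:ℝ), ∀ u : ℝ → ℝ, Differentiable ℝ u →
      Integrable (fun x => (u x)^2) →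
      Integrable (fun x => (deriv u x)^2) →
      (∫ x, φ₀ x * u x) = 0 →
      C₅ * ((∫ x, (deriv u x)^2) + ∫ x, (Qt x)^2 * (u x)^2)
        ≤ ∫ x, ((deriv u x)^2 + Vpot x * (u x)^2) := by
  obtain ⟨C, hC, hdec⟩ := hdecay
  have hμ : 0 < μ₀ := lt_of_lt_of_le (by norm_num) hμ1
  have hdφ : Differentiable ℝ φ₀ := hC2.differentiable (by norm_num)
  have hφ' : Integrable fun x => deriv φ₀ x ^ 2 := by
    have hi := (integrable_exp_neg_mul_abs
      (by positivity : 0 < 2 * (Real.sqrt 2 / 2 * μ₀))).const_mul (C ^ 2)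
    refine hi.mono' ((measurable_deriv φ₀).pow_const 2).aestronglyMeasurable
      (Eventually.of_forall fun x => ?_)
    have h1 : |deriv φ₀ x| ≤ C * Real.exp (-(Real.sqrt 2 / 2) * μ₀ * |x|) :=
      (le_add_of_nonneg_left (abs_nonneg _)).trans (hdec x)
    have h2 := pow_le_pow_left₀ (abs_nonneg _) h1 2
    rw [mul_pow, ← Real.exp_nat_mul] at h2
    rw [norm_pow, Real.norm_eq_abs]
    refine h2.trans (le_of_eq ?_)
    congr 2
    push_cast
    ring
  have hQφ := integrable_Qt_sq_mul hL2
  set N := ∫ x, φ₀ x ^ 2 with hN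
  set D := (∫ x, deriv φ₀ x ^ 2) + ∫ x, Qt x ^ 2 * φ₀ x ^ 2 with hD
  have hNpos : 0 < N :=
    integral_pos_of_integrable_nonneg_nonzero (x := 0) (hC2.continuous.pow 2) hL2
      (fun x => sq_nonneg _) (pow_pos (hpos 0) 2).ne'
  have hD0 : 0 ≤ D := add_nonneg (integral_nonneg fun x => sq_nonneg _)
    (integral_nonneg fun x => by positivity)
  refine ⟨min (1 / 6) (μ₀ ^ 2 * N / (2 * (D + 1))), lt_min (by norm_num) (by positivity), ?_⟩
  intro u hd hu hu' horth
  set c := min (1 / 6) (μ₀ ^ 2 * N / (2 * (D + 1)))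
  have hc0 : 0 < c := lt_min (by norm_num) (by positivity)
  have hc1 : c ≤ 1 / 6 := min_le_left _ _
  have hc2 : c * (2 * (D + 1)) ≤ μ₀ ^ 2 * N :=
    (le_div_iff₀ (by positivity)).1 (min_le_right _ _)
  obtain ⟨iu, eu⟩ := integral_bilinear_eq hC2 hL2 hφ' heq hd hu hu'
  obtain ⟨iφ, eφ⟩ := integral_bilinear_eq hC2 hL2 hφ' heq hdφ hL2 hφ'
  rw [horth, mul_zero] at eu
  have hNN : ∫ x, φ₀ x * φ₀ x = N := by simp only [hN, sq]
  rw [hNN] at eφ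
  set a := u 0 / φ₀ 0 with ha
  set w : ℝ → ℝ := fun x => u x - a * φ₀ x with hwdef
  have hdw : Differentiable ℝ w := hd.sub (hdφ.const_mul a)
  have hderw (x : ℝ) : deriv w x = deriv u x - a * deriv φ₀ x :=
    ((hd x).hasDerivAt.sub ((hdφ x).hasDerivAt.const_mul a)).deriv
  have hw0 : w 0 = 0 := by
    have := (hpos 0).ne'
    simp only [hwdef, ha]
    field_simp
    ring
  have iuφ := integrable_mul_of_sq hd.continuous.measurable hC2.continuous.measurable hu hL2
  have iuφ' := integrable_mul_of_sq (measurable_deriv u) (measurable_deriv φ₀) hu' hφ'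
  have hw : Integrable fun x => w x ^ 2 := by
    refine ((hu.sub (iuφ.const_mul (2 * a))).add (hL2.const_mul (a ^ 2))).congr
      (Eventually.of_forall fun x => ?_)
    simp only [hwdef, Pi.add_apply, Pi.sub_apply]
    ring
  have hw' : Integrable fun x => deriv w x ^ 2 := by
    refine ((hu'.sub (iuφ'.const_mul (2 * a))).add (hφ'.const_mul (a ^ 2))).congr
      (Eventually.of_forall fun x => ?_)
    simp only [hderw, Pi.add_apply, Pi.sub_apply]
    ring
  have hcoer := coercive_of_apply_zero_eq_zero hdw hw hw' hw0
  have hQu := integrable_Qt_sq_mul hu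
  have hQw := integrable_Qt_sq_mul hw
  have hVu := integrable_bounded_mul continuous_Vpot abs_Vpot_le hu
  have hB : ∫ x, (deriv w x ^ 2 + Vpot x * w x ^ 2)
      = (∫ x, (deriv u x ^ 2 + Vpot x * u x ^ 2)) - a ^ 2 * (μ₀ ^ 2 * N) := by
    have h1 := integral_add ((hu'.add hVu).sub (iu.const_mul (2 * a))) (iφ.const_mul (a ^ 2))
    have h2 := integral_sub (hu'.add hVu) (iu.const_mul (2 * a))
    simp only [Pi.add_apply, Pi.sub_apply, integral_const_mul] at h1 h2
    rw [h2, eu, eφ] at h1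
    calc _ = _ := integral_congr_ae (Eventually.of_forall fun x => by
          simp only [hderw]; simp only [hwdef]; ring)
      _ = _ := h1
      _ = _ := by ring
  have hDle : (∫ x, deriv u x ^ 2) + ∫ x, Qt x ^ 2 * u x ^ 2
      ≤ 2 * ((∫ x, deriv w x ^ 2) + ∫ x, Qt x ^ 2 * w x ^ 2) + 2 * a ^ 2 * D := by
    have iw : Integrable fun x => 2 * (deriv w x ^ 2 + Qt x ^ 2 * w x ^ 2) :=
      (hw'.add hQw).const_mul 2
    have iφ₀ : Integrable fun x => 2 * a ^ 2 * (deriv φ₀ x ^ 2 + Qt x ^ 2 * φ₀ x ^ 2) :=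
      (hφ'.add hQφ).const_mul _
    rw [hD, ← integral_add hu' hQu, ← integral_add hw' hQw, ← integral_add hφ' hQφ,
      ← integral_const_mul, ← integral_const_mul, ← integral_add iw iφ₀]
    refine integral_mono (hu'.add hQu) (iw.add iφ₀) fun x => ?_
    simp only [hderw]
    simp only [hwdef]
    have h1 := sq_nonneg (deriv u x - 2 * a * deriv φ₀ x)
    have h2 := mul_nonneg (sq_nonneg (Qt x)) (sq_nonneg (u x - 2 * a * φ₀ x))
    linarith
  have hDw : 0 ≤ (∫ x, deriv w x ^ 2) + ∫ x, Qt x ^ 2 * w x ^ 2 :=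
    add_nonneg (integral_nonneg fun x => sq_nonneg _) (integral_nonneg fun x => by positivity)
  have h1 := mul_le_mul_of_nonneg_left hDle hc0.le
  have h2 := mul_le_mul_of_nonneg_right hc1 hDw
  have h3 := mul_le_mul_of_nonneg_left hc2 (sq_nonneg a)
  have h4 : 0 ≤ a ^ 2 * c := by positivity
  linarith
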